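/- arXiv:2512.05667 — 4 statements merged into one kernel-verified Lean document; each statement's English description precedes it below -/
import Mathlib

section
/- Let O and B be types, let c be a nonempty finite subset of O, and let b : O → B, ρL : O → ℝ, ρF : O → ℝ. Say that o' strictly Pareto-dominates o within its belief class if b o' = b o, ρL o' ≥ ρL o, ρF o' ≥ ρF o, and at least one of these two inequalities is strict. Let 𝔽(c) be the set of elements of c that are not strictly Pareto-dominated within their belief class by any element of c. For a nonempty finite S ⊆ O, define R(S) as the maximum of ρL over the set of elements of S attaining the maximum of ρF over S. Then the maximum of ρF over 𝔽(c) equals the maximum of ρF over c, and R(𝔽(c)) = R(c). -/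
/-- A nonempty finite set has an element maximizing `f`, and maximizing `g` among the
maximizers of `f`. -/
theorem exists_lex_max {O : Type*} (c : Finset O) (hc : c.Nonempty) (g f : O → ℝ) :
    ∃ y ∈ c, (∀ z ∈ c, f z ≤ f y) ∧ ∀ z ∈ c, f z = f y → g z ≤ g y := by
  obtain ⟨y, hy, hmax⟩ := c.exists_max_image (fun o => toLex (f o, g o)) hc
  simp only [Prod.Lex.toLex_le_toLex] at hmax
  exact ⟨y, hy, fun z hz => (hmax z hz).elim le_of_lt fun h => h.1.le,
    fun z hz hzy => (hmax z hz).elim (fun h => absurd hzy h.ne) fun h => h.2⟩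

/-- A lexicographic maximizer of `(f, g)` on `S` computes both the supremum of `f` and the
supremum of `g` over the maximizers of `f`. -/
theorem sSup_image_of_lex_max {O : Type*} {S : Set O} (g f : O → ℝ) {y : O} (hy : y ∈ S)
    (hf : ∀ z ∈ S, f z ≤ f y) (hg : ∀ z ∈ S, f z = f y → g z ≤ g y) :
    sSup (f '' S) = f y ∧ sSup (g '' {o ∈ S | f o = sSup (f '' S)}) = g y := by
  have hsup : sSup (f '' S) = f y :=
    IsGreatest.csSup_eq ⟨Set.mem_image_of_mem f hy, Set.forall_mem_image.mpr hf⟩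
  rw [hsup]
  exact ⟨rfl, IsGreatest.csSup_eq
    ⟨⟨y, ⟨hy, rfl⟩, rfl⟩, Set.forall_mem_image.mpr fun z hz => hg z hz.1 hz.2⟩⟩

/-- Losslessness of belief-based filtering: if `𝔽 c` removes from the nonempty finite set
`c` the occupancy states strictly Pareto-dominated (in `(ρL, ρF)`) by another element of
`c` with the same marginal belief `b`, and `R S` is the maximum of `ρL` over the elements
of `S` attaining the maximum of `ρF` over `S` (leader-favourable tie-breaking), then the
maximum of `ρF` and the reward `R` are unchanged by filtering. -/
theorem stmt1 {O B : Type*} (c : Finset O) (hc : c.Nonempty)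
    (b : O → B) (ρL ρF : O → ℝ)
    (F : Set O)
    (hF : F = {o | o ∈ c ∧ ¬ ∃ o' ∈ c,
      b o' = b o ∧ ρL o ≤ ρL o' ∧ ρF o ≤ ρF o' ∧ (ρL o < ρL o' ∨ ρF o < ρF o')})
    (R : Set O → ℝ)
    (hR : ∀ S : Set O, R S = sSup (ρL '' {o ∈ S | ρF o = sSup (ρF '' S)})) :
    sSup (ρF '' F) = sSup (ρF '' (c : Set O)) ∧ R F = R (c : Set O) := by
  obtain ⟨y, hy, hF_max, hL_max⟩ := exists_lex_max c hc ρL ρF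
  have hyF : y ∈ F := by
    rw [hF]
    refine ⟨hy, ?_⟩
    rintro ⟨z, hz, -, -, hFz, hlt⟩
    have hFeq : ρF z = ρF y := le_antisymm (hF_max z hz) hFz
    rcases hlt with hlt | hlt
    · exact absurd (hL_max z hz hFeq) (not_le.mpr hlt)
    · exact absurd hFeq hlt.ne'
  have hFc : ∀ z ∈ F, z ∈ c := fun z hz => by
    rw [hF] at hz
    exact hz.1
  obtain ⟨hF₁, hF₂⟩ := sSup_image_of_lex_max ρL ρF hyF (fun z hz => hF_max z (hFc z hz))
    fun z hz => hL_max z (hFc z hz)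
  obtain ⟨hc₁, hc₂⟩ := sSup_image_of_lex_max (S := (c : Set O)) ρL ρF hy hF_max hL_max
  exact ⟨hF₁.trans hc₁.symm, by rw [hR, hR, hF₂, hc₂]⟩
end

section
/- Let V be a finite type with card(V) = N ≥ 1, let π : V → V, let s₀ ∈ V, and let γ be a real number with 0 < γ < 1. Then ∑_{t=0}^{∞} γ^t · (if π^[t](s₀) = s₀ then 1 else 0) = 1 / (1 − γ^N) if and only if the map t ↦ π^[t](s₀) is injective on {0, 1, …, N−1} and π^[N](s₀) = s₀ (i.e., the orbit of s₀ under π is a cycle visiting every element of V exactly once per period). -/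
theorem hasSum_pow_mul_ite_dvd {γ : ℝ} (hγ0 : 0 ≤ γ) (hγ1 : γ < 1) {p : ℕ} (hp : 0 < p) :
    HasSum (fun t : ℕ => γ ^ t * (if p ∣ t then (1 : ℝ) else 0)) (1 / (1 - γ ^ p)) := by
  have hinj : Function.Injective (fun k : ℕ => p * k) := mul_right_injective₀ hp.ne'
  rw [← hinj.hasSum_iff]
  · simpa [Function.comp_def, pow_mul] using
      hasSum_geometric_of_lt_one (pow_nonneg hγ0 p) (pow_lt_one₀ hγ0 hγ1 hp.ne')
  · intro t ht
    have : ¬ p ∣ t := fun ⟨k, hk⟩ => ht ⟨k, hk.symm⟩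
    simp [this]

theorem injOn_iterate_and_iterate_eq_iff_minimalPeriod_eq {α : Type*} (f : α → α) (x : α)
    {n : ℕ} (hn : 0 < n) :
    (Set.InjOn (fun t : ℕ => f^[t] x) (Set.Iio n) ∧ f^[n] x = x) ↔
      Function.minimalPeriod f x = n := by
  constructor
  · rintro ⟨hinj, hper⟩
    have hper' : Function.IsPeriodicPt f n x := hper
    have hpos := hper'.minimalPeriod_pos hn
    refine (hper'.minimalPeriod_le hn).antisymm (not_lt.mp fun hlt => hpos.ne' ?_)
    exact hinj hlt hn (by simp [Function.iterate_minimalPeriod])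
  · rintro rfl
    exact ⟨Function.iterate_injOn_Iio_minimalPeriod, Function.iterate_minimalPeriod⟩

open Classical in
/-- Hamiltonian-cycle characterisation of the exact discounted value: on a finite type
`V` with `card V = N ≥ 1`, the deterministic trajectory of `π` from `s₀` (reward 1
exactly when at `s₀`, discount `γ ∈ (0,1)`) has value `1 / (1 - γ^N)` if and only if
`t ↦ π^[t] s₀` is injective on `{0, …, N-1}` and `π^[N] s₀ = s₀`, i.e. the orbit of
`s₀` is a cycle visiting every element of `V` exactly once per period. -/
theorem stmt8 {V : Type*} [Fintype V] (N : ℕ) (hcard : Fintype.card V = N)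
    (hN : 1 ≤ N) (π : V → V) (s₀ : V) (γ : ℝ) (hγ0 : 0 < γ) (hγ1 : γ < 1) :
    (∑' t : ℕ, γ ^ t * (if π^[t] s₀ = s₀ then (1 : ℝ) else 0)) = 1 / (1 - γ ^ N) ↔
      (Set.InjOn (fun t : ℕ => π^[t] s₀) (Set.Iio N) ∧ π^[N] s₀ = s₀) := by
  rw [injOn_iterate_and_iterate_eq_iff_minimalPeriod_eq π s₀ hN]
  have hdvd : ∀ t : ℕ, π^[t] s₀ = s₀ ↔ Function.minimalPeriod π s₀ ∣ t := fun t =>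
    Function.isPeriodicPt_iff_minimalPeriod_dvd
  simp only [hdvd]
  have hne : ∀ {n : ℕ}, 0 < n → 1 - γ ^ n ≠ 0 := fun hn =>
    (sub_pos.mpr (pow_lt_one₀ hγ0.le hγ1 hn.ne')).ne'
  rcases Nat.eq_zero_or_pos (Function.minimalPeriod π s₀) with hp | hp
  · have hsum :
        (∑' t : ℕ, γ ^ t * (if Function.minimalPeriod π s₀ ∣ t then (1 : ℝ) else 0)) = 1 := by
      rw [tsum_eq_single 0 fun t ht => by simp [hp, ht]]
      simp
    rw [hsum, hp, eq_div_iff (hne hN)]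
    have := pow_pos hγ0 N
    constructor
    · intro h
      linarith
    · intro h
      omega
  · rw [(hasSum_pow_mul_ite_dvd hγ0.le hγ1 hp).tsum_eq]
    constructor
    · intro h
      rw [div_eq_div_iff (hne hp) (hne hN)] at h
      exact pow_right_injective₀ hγ0 hγ1.ne (by dsimp only; linarith)
    · intro h
      rw [h]
end

section
/- Let n and B be natural numbers with n < B, and let f : Fin n → Fin n. Then ∑_{t : Fin n} B^{(f t)} = ∑_{i=0}^{n−1} B^{i} if and only if f is bijective. -/
/-- Uniqueness of base-`B` representations with a fixed number of digits. -/
theorem eq_of_sum_mul_pow_eq {B n : ℕ} {c d : Fin n → ℕ} (hc : ∀ i, c i < B) (hd : ∀ i, d i < B)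
    (h : ∑ i, c i * B ^ (i : ℕ) = ∑ i, d i * B ^ (i : ℕ)) : c = d := by
  induction n with
  | zero => exact Subsingleton.elim c d
  | succ n ih =>
    have split (e : Fin (n + 1) → ℕ) :
        ∑ i, e i * B ^ (i : ℕ) = e 0 + B * ∑ i : Fin n, e i.succ * B ^ (i : ℕ) := by
      rw [Fin.sum_univ_succ, Finset.mul_sum]
      simp [pow_succ', mul_left_comm]
    rw [split c, split d] at h
    have h0 : c 0 = d 0 := by
      simpa [Nat.add_mul_mod_self_left, Nat.mod_eq_of_lt, hc, hd] using congrArg (· % B) h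
    rw [h0] at h
    have hB : 0 < B := (Nat.zero_le _).trans_lt (hc 0)
    have hs := ih (fun i => hc i.succ) (fun i => hd i.succ)
      (Nat.eq_of_mul_eq_mul_left hB (Nat.add_left_cancel h))
    funext i
    exact Fin.cases h0 (congrFun hs) i

/-- Uniqueness of base-`B` representations, as used in the NP-hardness reduction from
Hamiltonian path: for `n < B` and `f : Fin n → Fin n`, the total reward
`∑_t B^(f t)` equals `∑_{i<n} B^i` if and only if `f` is bijective. -/
theorem stmt9 (n B : ℕ) (h : n < B) (f : Fin n → Fin n) :
    (∑ t : Fin n, B ^ (f t : ℕ)) = ∑ i ∈ Finset.range n, B ^ i ↔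
      Function.Bijective f := by
  rw [← Fin.sum_univ_eq_sum_range (fun i => B ^ i)]
  refine ⟨fun hsum => ?_, fun hf => hf.sum_comp fun i : Fin n => B ^ (i : ℕ)⟩
  have hcount : ∑ t, B ^ (f t : ℕ) =
      ∑ i, (Finset.univ.filter fun t => f t = i).card * B ^ (i : ℕ) := by
    rw [← Finset.sum_fiberwise Finset.univ f]
    refine Finset.sum_congr rfl fun i _ => ?_
    rw [← smul_eq_mul]
    refine Finset.sum_eq_card_nsmul fun t ht => ?_
    rw [(Finset.mem_filter.mp ht).2]
  have hcard : (fun i => (Finset.univ.filter fun t => f t = i).card) = fun _ => 1 := by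
    refine eq_of_sum_mul_pow_eq (B := B) (fun i => ?_) (fun i => ?_) ?_
    · exact (Finset.card_le_univ _).trans_lt (by simpa using h)
    · exact (Nat.succ_le_of_lt i.pos).trans_lt h
    · simpa only [one_mul, hcount] using hsum
  refine Finite.surjective_iff_bijective.mp fun i => ?_
  obtain ⟨t, ht⟩ := Finset.card_pos.mp ((congrFun hcard i).symm ▸ Nat.one_pos)
  exact ⟨t, (Finset.mem_filter.mp ht).2⟩
end

section
/- Let V be a finite type with card(V) = n, let e : V ≃ Fin n be a bijection assigning indices to elements, let B be a natural number with n < B, let π : V → V, and let s₀ ∈ V. Then ∑_{t : Fin n} B^{(e(π^[t](s₀)))} = ∑_{i=0}^{n−1} B^{i} if and only if the map t ↦ π^[t](s₀) is injective on Fin n (i.e., the first n states of the trajectory of π from s₀ are pairwise distinct, so the trajectory visits every element of V exactly once). -/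
/-- Base-`B` expansions of a fixed length with digits less than `B` are unique. -/
theorem eq_of_sum_mul_pow_eq_s10 {B : ℕ} : ∀ {n : ℕ} {c d : Fin n → ℕ}, (∀ i, c i < B) →
    (∀ i, d i < B) → ∑ i, c i * B ^ (i : ℕ) = ∑ i, d i * B ^ (i : ℕ) → c = d
  | 0, _, _, _, _, _ => Subsingleton.elim _ _
  | n + 1, c, d, hc, hd, h => by
    have expand (a : Fin (n + 1) → ℕ) : ∑ i, a i * B ^ (i : ℕ) =
        a 0 + B * ∑ i : Fin n, a i.succ * B ^ (i : ℕ) := by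
      rw [Fin.sum_univ_succ, Finset.mul_sum]
      simp [pow_succ, mul_comm, mul_left_comm]
    rw [expand, expand] at h
    have h0 : c 0 = d 0 := by
      simpa [Nat.add_mul_mod_self_left, Nat.mod_eq_of_lt, hc 0, hd 0] using congrArg (· % B) h
    rw [h0] at h
    have hB : 0 < B := (Nat.zero_le _).trans_lt (hc 0)
    have hs := eq_of_sum_mul_pow_eq_s10 (fun i => hc i.succ) (fun i => hd i.succ)
      (Nat.eq_of_mul_eq_mul_left hB (Nat.add_left_cancel h))
    funext i
    exact Fin.cases h0 (congrFun hs) i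

/-- A self-map `f` of `Fin n` is injective exactly when the powers `B ^ f t` of a base `B > n`
add up to `1 + B + ⋯ + B ^ (n - 1)`. -/
theorem sum_pow_eq_sum_range_pow_iff_injective {n B : ℕ} (hB : n < B) (f : Fin n → Fin n) :
    ∑ t, B ^ (f t : ℕ) = ∑ i ∈ Finset.range n, B ^ i ↔ Function.Injective f := by
  rw [← Fin.sum_univ_eq_sum_range]
  constructor
  · intro h
    have fiber : ∑ t, B ^ (f t : ℕ) =
        ∑ i : Fin n, (Finset.univ.filter (fun t => f t = i)).card * B ^ (i : ℕ) := by
      rw [← Finset.sum_fiberwise Finset.univ f]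
      refine Finset.sum_congr rfl fun i _ => ?_
      rw [← smul_eq_mul, ← Finset.sum_const]
      exact Finset.sum_congr rfl fun t ht => by rw [(Finset.mem_filter.mp ht).2]
    have hcard : (fun i => (Finset.univ.filter (fun t => f t = i)).card) = fun _ => 1 := by
      refine eq_of_sum_mul_pow_eq_s10 (B := B) (fun i => ?_) (fun i => ?_) ?_
      · exact ((Finset.card_le_univ _).trans_eq (Fintype.card_fin n)).trans_lt hB
      · exact (Nat.succ_le_of_lt i.pos).trans_lt hB
      · simpa only [one_mul] using fiber.symm.trans h
    intro s t hst
    exact Finset.card_le_one.mp (congrFun hcard (f t)).le s (by simp [hst]) t (by simp)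
  · intro h
    exact (Finite.injective_iff_bijective.mp h).sum_comp fun i : Fin n => B ^ (i : ℕ)


/-- Trajectory-level correctness of the Hamiltonian-path reduction: with indices
assigned by a bijection `e : V ≃ Fin n` and a base `B > n`, the trajectory of `π`
from `s₀` accumulates total reward `∑_{t<n} B^(e (π^[t] s₀)) = ∑_{i<n} B^i` if and
only if its first `n` states are pairwise distinct, i.e. the trajectory visits every
element of `V` exactly once. -/
theorem stmt10 {V : Type*} (n B : ℕ) (hB : n < B)
    (e : V ≃ Fin n) (π : V → V) (s₀ : V) :
    (∑ t : Fin n, B ^ ((e (π^[(t : ℕ)] s₀)) : ℕ)) = ∑ i ∈ Finset.range n, B ^ i ↔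
      Function.Injective (fun t : Fin n => π^[(t : ℕ)] s₀) := by
  rw [← e.injective.of_comp_iff]
  exact sum_pow_eq_sum_range_pow_iff_injective hB fun t => e (π^[(t : ℕ)] s₀)
end
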